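/- There exists a universal constant c > 0 such that for every integer d ≥ 1, every L ≥ 0, and every L-Lipschitz function h : ℝ^d → ℝ, if u is uniformly distributed on the unit sphere 𝕊 of ℝ^d, then √(E[(h(u) − E[h(u)])⁴]) ≤ c·L²/d. -/

import Mathlib

open MeasureTheory

/-- The uniform probability measure on the closed unit ball of `ℝ^d`. -/
noncomputable def ballUniform (d : ℕ) : Measure (EuclideanSpace ℝ (Fin d)) :=
  (volume (Metric.closedBall (0 : EuclideanSpace ℝ (Fin d)) 1))⁻¹ •
    volume.restrict (Metric.closedBall (0 : EuclideanSpace ℝ (Fin d)) 1)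

/-- The uniform (rotation-invariant) probability measure on the unit sphere of `ℝ^d`,
realized as the pushforward of the uniform measure on the unit ball under the radial
projection `v ↦ v / ‖v‖`. -/
noncomputable def sphereUniform (d : ℕ) : Measure (EuclideanSpace ℝ (Fin d)) :=
  Measure.map (fun v => ‖v‖⁻¹ • v) (ballUniform d)

open ProbabilityTheory Filter Module
open scoped RealInnerProductSpace Topology NNReal ENNReal

section Polar

variable {E : Type*} [NormedAddCommGroup E] [NormedSpace ℝ E] [Nontrivial E]
  [FiniteDimensional ℝ E] [MeasurableSpace E] [BorelSpace E]

/-- Polar decomposition of the integral of the product of a radial and an angular function. -/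
lemma integral_norm_mul_direction (μ : Measure E) [μ.IsAddHaarMeasure] (f : ℝ → ℝ) (φ : E → ℝ) :
    ∫ x, f ‖x‖ * φ (‖x‖⁻¹ • x) ∂μ =
      (∫ u, φ u ∂μ.toSphere) * ∫ r, f r ∂Measure.volumeIoiPow (finrank ℝ E - 1) := by
  calc
    ∫ x, f ‖x‖ * φ (‖x‖⁻¹ • x) ∂μ
      = ∫ x : ({0}ᶜ : Set E), f ‖x.1‖ * φ (‖x.1‖⁻¹ • x.1) ∂(μ.comap (↑)) := by
      rw [integral_subtype_comap (measurableSet_singleton _).compl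
        fun x ↦ f ‖x‖ * φ (‖x‖⁻¹ • x), restrict_compl_singleton]
    _ = ∫ x, φ x.1 * f x.2 ∂μ.toSphere.prod (.volumeIoiPow (finrank ℝ E - 1)) := by
      simpa [mul_comm] using μ.measurePreserving_homeomorphUnitSphereProd.integral_comp
        (Homeomorph.measurableEmbedding _) (fun p ↦ φ p.1 * f p.2)
    _ = _ := integral_prod_mul (fun u : Metric.sphere (0 : E) 1 ↦ φ u)
      (fun r : Set.Ioi (0 : ℝ) ↦ f r)

lemma integral_norm_mul_direction_mul_comm (μ : Measure E) [μ.IsAddHaarMeasure]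
    (f g : ℝ → ℝ) (φ : E → ℝ) :
    (∫ x, f ‖x‖ * φ (‖x‖⁻¹ • x) ∂μ) * ∫ x, g ‖x‖ ∂μ =
      (∫ x, g ‖x‖ * φ (‖x‖⁻¹ • x) ∂μ) * ∫ x, f ‖x‖ ∂μ := by
  have hf := integral_norm_mul_direction μ f (fun _ ↦ 1)
  have hg := integral_norm_mul_direction μ g (fun _ ↦ 1)
  simp only [mul_one] at hf hg
  rw [hf, hg, integral_norm_mul_direction, integral_norm_mul_direction]
  ring

end Polar

lemma integral_sphereUniform (d : ℕ) {φ : EuclideanSpace ℝ (Fin d) → ℝ} (hφ : Continuous φ) :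
    ∫ u, φ u ∂sphereUniform d =
      (volume.real (Metric.closedBall (0 : EuclideanSpace ℝ (Fin d)) 1))⁻¹ *
        ∫ x : EuclideanSpace ℝ (Fin d), (Set.Iic 1).indicator 1 ‖x‖ * φ (‖x‖⁻¹ • x) := by
  have hm : Measurable fun v : EuclideanSpace ℝ (Fin d) ↦ ‖v‖⁻¹ • v := by fun_prop
  rw [sphereUniform, integral_map hm.aemeasurable hφ.aestronglyMeasurable, ballUniform,
    integral_smul_measure, ENNReal.toReal_inv, smul_eq_mul, ← measureReal_def,
    ← integral_indicator Metric.isClosed_closedBall.measurableSet]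
  congr 2 with x
  by_cases hx : ‖x‖ ≤ 1 <;> simp [Set.indicator, hx]

lemma integral_sphereUniform_mul_integral_norm {d : ℕ} (hd : d ≠ 0)
    {φ : EuclideanSpace ℝ (Fin d) → ℝ} (hφ : Continuous φ) (f : ℝ → ℝ) :
    ∫ x : EuclideanSpace ℝ (Fin d), f ‖x‖ * φ (‖x‖⁻¹ • x) =
      (∫ u, φ u ∂sphereUniform d) * ∫ x : EuclideanSpace ℝ (Fin d), f ‖x‖ := by
  have : NeZero d := ⟨hd⟩
  have hball : ∫ x : EuclideanSpace ℝ (Fin d), (Set.Iic 1).indicator (1 : ℝ → ℝ) ‖x‖ =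
      volume.real (Metric.closedBall (0 : EuclideanSpace ℝ (Fin d)) 1) := by
    rw [← integral_indicator_one Metric.isClosed_closedBall.measurableSet]
    congr 1 with x
    by_cases hx : ‖x‖ ≤ 1 <;> simp [Set.indicator, hx]
  have hpos : 0 < volume.real (Metric.closedBall (0 : EuclideanSpace ℝ (Fin d)) 1) :=
    ENNReal.toReal_pos (Metric.measure_closedBall_pos _ _ one_pos).ne'
      measure_closedBall_lt_top.ne
  have h := integral_norm_mul_direction_mul_comm (volume : Measure (EuclideanSpace ℝ (Fin d)))
    f ((Set.Iic 1).indicator 1) φ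
  rw [hball] at h
  rw [integral_sphereUniform d hφ, mul_assoc, ← h]
  field_simp

instance isProbabilityMeasure_sphereUniform (d : ℕ) : IsProbabilityMeasure (sphereUniform d) := by
  have : IsProbabilityMeasure (ballUniform d) := ⟨by
    simp only [ballUniform, Measure.smul_apply, Measure.restrict_apply_univ, smul_eq_mul]
    exact ENNReal.inv_mul_cancel (Metric.measure_closedBall_pos _ _ one_pos).ne'
      measure_closedBall_lt_top.ne⟩
  have hm : Measurable fun v : EuclideanSpace ℝ (Fin d) ↦ ‖v‖⁻¹ • v := by fun_prop
  exact Measure.isProbabilityMeasure_map hm.aemeasurable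

section Gaussian

variable {E : Type*} [NormedAddCommGroup E] [InnerProductSpace ℝ E]
  [FiniteDimensional ℝ E] [MeasurableSpace E] [BorelSpace E]

lemma stdGaussian_eq_withDensity :
    stdGaussian E = volume.withDensity fun x ↦ ENNReal.ofReal
      (((2 * Real.pi) ^ (finrank ℝ E / 2 : ℝ))⁻¹ * Real.exp (-(1 / 2) * ‖x‖ ^ 2)) := by
  have hc : 0 < (2 * Real.pi) ^ (finrank ℝ E / 2 : ℝ) := by positivity
  have hint : Integrable fun x : E ↦ Real.exp (-(1 / 2) * ‖x‖ ^ 2) := by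
    have h := (GaussianFourier.integrable_cexp_neg_mul_sq_norm_add (V := E) (b := 1 / 2)
      (by norm_num) 0 0).norm
    refine h.congr (.of_forall fun x ↦ ?_)
    simp [Complex.norm_exp, ← Complex.ofReal_pow]
  have hfin : IsFiniteMeasure ((volume : Measure E).withDensity fun x ↦ ENNReal.ofReal
      (((2 * Real.pi) ^ (finrank ℝ E / 2 : ℝ))⁻¹ * Real.exp (-(1 / 2) * ‖x‖ ^ 2))) :=
    isFiniteMeasure_withDensity_ofReal (hint.const_mul _).2
  refine Measure.ext_of_charFun ?_
  ext t
  rw [charFun_stdGaussian, charFun_apply, integral_withDensity_eq_integral_toReal_smul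
    (by fun_prop) (by simp)]
  have h := GaussianFourier.integral_cexp_neg_mul_sq_norm_add (V := E) (b := 1 / 2)
      (by norm_num) Complex.I t
  have key : ∀ x : E, (ENNReal.ofReal (((2 * Real.pi) ^ (finrank ℝ E / 2 : ℝ))⁻¹ *
      Real.exp (-(1 / 2) * ‖x‖ ^ 2))).toReal • Complex.exp (⟪x, t⟫ * Complex.I) =
      (((2 * Real.pi) ^ (finrank ℝ E / 2 : ℝ) : ℝ) : ℂ)⁻¹ *
        Complex.exp (-(1 / 2) * ‖x‖ ^ 2 + Complex.I * ⟪t, x⟫) := by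
    intro x
    rw [ENNReal.toReal_ofReal (by positivity), Complex.exp_add, Complex.real_smul,
      real_inner_comm, mul_comm Complex.I]
    push_cast
    ring
  simp_rw [key]
  rw [integral_const_mul, h, Complex.ofReal_cpow (by positivity)]
  have hc' : (2 * Real.pi : ℂ) ^ (finrank ℝ E / 2 : ℂ) ≠ 0 := by
    have : ((2 * Real.pi : ℝ) : ℂ) ^ ((finrank ℝ E / 2 : ℝ) : ℂ) ≠ 0 := by
      rw [← Complex.ofReal_cpow (by positivity)]
      exact_mod_cast hc.ne'
    push_cast at this
    exact this
  have he : (Real.pi : ℂ) / (1 / 2) = 2 * Real.pi := by ring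
  rw [he]
  push_cast
  rw [inv_mul_cancel_left₀ hc', Complex.I_sq]
  congr 1
  ring

lemma stdGaussian_absolutelyContinuous : stdGaussian E ≪ volume := by
  rw [stdGaussian_eq_withDensity]
  exact withDensity_absolutelyContinuous _ _

lemma integral_stdGaussian (F : E → ℝ) :
    ∫ x, F x ∂stdGaussian E = ∫ x, (((2 * Real.pi) ^ (finrank ℝ E / 2 : ℝ))⁻¹ *
      Real.exp (-(1 / 2) * ‖x‖ ^ 2)) * F x := by
  rw [stdGaussian_eq_withDensity, integral_withDensity_eq_integral_toReal_smul
    (by fun_prop) (by simp)]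
  congr 1 with x
  rw [ENNReal.toReal_ofReal (by positivity), smul_eq_mul]

/-- Under the standard Gaussian measure, the norm and the direction are independent, and the
direction is uniform on the sphere. -/
lemma integral_stdGaussian_norm_mul_direction {d : ℕ} (hd : d ≠ 0)
    {φ : EuclideanSpace ℝ (Fin d) → ℝ} (hφ : Continuous φ) (f : ℝ → ℝ) :
    ∫ x, f ‖x‖ * φ (‖x‖⁻¹ • x) ∂stdGaussian (EuclideanSpace ℝ (Fin d)) =
      (∫ u, φ u ∂sphereUniform d) * ∫ x, f ‖x‖ ∂stdGaussian (EuclideanSpace ℝ (Fin d)) := by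
  simp_rw [integral_stdGaussian, ← mul_assoc]
  exact integral_sphereUniform_mul_integral_norm hd hφ fun r ↦
    (((2 * Real.pi) ^ (finrank ℝ (EuclideanSpace ℝ (Fin d)) / 2 : ℝ))⁻¹ *
      Real.exp (-(1 / 2) * r ^ 2)) * f r

/-- A function with at most quartic growth is integrable against a Gaussian measure. -/
lemma integrable_of_abs_le_norm_pow_four {F : Type*} [NormedAddCommGroup F] [NormedSpace ℝ F]
    [MeasurableSpace F] [BorelSpace F] [CompleteSpace F] [SecondCountableTopology F]
    (μ : Measure F) [IsGaussian μ] {f : F → ℝ} (hf : AEStronglyMeasurable f μ) (C : ℝ)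
    (hC : ∀ x, |f x| ≤ C * ‖x‖ ^ 4) : Integrable f μ := by
  have h : Integrable (fun x : F ↦ ‖x‖ ^ 4) μ :=
    (IsGaussian.memLp_id μ 4 (by norm_num)).integrable_norm_pow (by norm_num)
  exact (h.const_mul C).mono' hf (.of_forall hC)

lemma integral_strongDual_pow_four_stdGaussian (L : StrongDual ℝ E) :
    ∫ y, L y ^ 4 ∂stdGaussian E = ‖L‖ ^ 4 * ∫ z, z ^ 4 ∂gaussianReal 0 1 := by
  have h1 : (stdGaussian E).map L = (gaussianReal 0 1).map (‖L‖ * ·) := by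
    rw [IsGaussian.map_eq_gaussianReal L, integral_strongDual_stdGaussian,
      variance_dual_stdGaussian, gaussianReal_map_const_mul]
    congr 1
    · simp
    · ext; simp
  rw [← integral_map (f := fun z : ℝ ↦ z ^ 4) L.continuous.aemeasurable (by fun_prop), h1,
    integral_map (by fun_prop) (by fun_prop)]
  simp_rw [mul_pow]
  rw [integral_const_mul]

lemma sq_le_integral_norm_pow_four_stdGaussian (d : ℕ) :
    (d : ℝ) ^ 2 ≤ ∫ x, ‖x‖ ^ 4 ∂stdGaussian (EuclideanSpace ℝ (Fin d)) := by
  set γ := stdGaussian (EuclideanSpace ℝ (Fin d))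
  have h2 : ∫ x, ‖x‖ ^ 2 ∂γ = d := by
    have hi (i : Fin d) : ∫ x, x i ^ 2 ∂γ = 1 := by
      let L := innerSL ℝ (EuclideanSpace.basisFun (Fin d) ℝ i)
      have hL (x) : L x = x i := by simp [L, PiLp.inner_apply]
      have h := variance_dual_stdGaussian L
      rw [variance_of_integral_eq_zero (by fun_prop) (integral_strongDual_stdGaussian L)] at h
      simp_rw [hL] at h
      rw [h]
      simp [L]
    simp_rw [EuclideanSpace.real_norm_sq_eq]
    rw [integral_finsetSum]
    · simp [hi]
    · intro i _
      have : Integrable (fun x : EuclideanSpace ℝ (Fin d) ↦ ‖x‖ ^ 2) γ :=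
        (IsGaussian.memLp_id γ 2 (by norm_num)).integrable_norm_pow (by norm_num)
      refine this.mono' (by fun_prop) (.of_forall fun x ↦ ?_)
      simpa using pow_le_pow_left₀ (norm_nonneg _) (PiLp.norm_apply_le x i) 2
  have hint2 : Integrable (fun x : EuclideanSpace ℝ (Fin d) ↦ ‖x‖ ^ 2) γ :=
    (IsGaussian.memLp_id γ 2 (by norm_num)).integrable_norm_pow (by norm_num)
  have hint4 : Integrable (fun x : EuclideanSpace ℝ (Fin d) ↦ ‖x‖ ^ 4) γ :=
    (IsGaussian.memLp_id γ 4 (by norm_num)).integrable_norm_pow (by norm_num)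
  calc (d : ℝ) ^ 2 = ∫ x, (2 * d * ‖x‖ ^ 2 - d ^ 2) ∂γ := by
        rw [integral_sub (hint2.const_mul _) (integrable_const _), integral_const_mul, h2]
        simp
        ring
    _ ≤ ∫ x, ‖x‖ ^ 4 ∂γ := by
        refine integral_mono ((hint2.const_mul _).sub (integrable_const _)) hint4 fun x ↦ ?_
        nlinarith [sq_nonneg (‖x‖ ^ 2 - d)]

lemma rotation_add_apply {F : Type*} [SeminormedAddCommGroup F] [NormedSpace ℝ F] (s t : ℝ)
    (p : F × F) :
    ContinuousLinearMap.rotation s (ContinuousLinearMap.rotation t p) =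
      ContinuousLinearMap.rotation (s + t) p := by
  simp only [ContinuousLinearMap.rotation_apply, Real.cos_add, Real.sin_add]
  ext <;> simp only <;> module

lemma norm_fst_sub_rotation_le {F : Type*} [SeminormedAddCommGroup F] [NormedSpace ℝ F] (t : ℝ)
    (p : F × F) :
    ‖p.1 - (ContinuousLinearMap.rotation t p).1‖ ≤ 2 * |t| * ‖p‖ := by
  have h1 : |1 - Real.cos t| ≤ |t| := by
    simpa using Real.abs_cos_sub_cos_le 0 t
  have h2 : |Real.sin t| ≤ |t| := Real.abs_sin_le_abs
  have h3 : p.1 - (ContinuousLinearMap.rotation t p).1 =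
      (1 - Real.cos t) • p.1 - Real.sin t • p.2 := by
    rw [ContinuousLinearMap.rotation_apply]
    module
  calc ‖p.1 - (ContinuousLinearMap.rotation t p).1‖
      ≤ |1 - Real.cos t| * ‖p.1‖ + |Real.sin t| * ‖p.2‖ := by
        rw [h3]
        exact (norm_sub_le _ _).trans_eq (by simp [norm_smul])
    _ ≤ |t| * ‖p‖ + |t| * ‖p‖ := by
        gcongr
        exacts [norm_fst_le p, norm_snd_le p]
    _ = 2 * |t| * ‖p‖ := by ring

lemma abs_sub_rotation_le {F : Type*} [SeminormedAddCommGroup F] [NormedSpace ℝ F] {K : ℝ≥0}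
    {g : F → ℝ} (hg : LipschitzWith K g) (t : ℝ) (p : F × F) :
    |g p.1 - g (ContinuousLinearMap.rotation t p).1| ≤ 2 * K * |t| * ‖p‖ := by
  calc |g p.1 - g (ContinuousLinearMap.rotation t p).1|
      ≤ K * ‖p.1 - (ContinuousLinearMap.rotation t p).1‖ := by
        simpa [Real.dist_eq, dist_eq_norm] using hg.dist_le_mul p.1
          (ContinuousLinearMap.rotation t p).1
    _ ≤ K * (2 * |t| * ‖p‖) := by gcongr; exact norm_fst_sub_rotation_le t p
    _ = 2 * K * |t| * ‖p‖ := by ring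

lemma integrable_sub_rotation_pow_four {K : ℝ≥0} {g : E → ℝ} (hg : LipschitzWith K g) (t : ℝ) :
    Integrable (fun p : E × E ↦ (g p.1 - g (ContinuousLinearMap.rotation t p).1) ^ 4)
      ((stdGaussian E).prod (stdGaussian E)) := by
  have := hg.continuous
  refine integrable_of_abs_le_norm_pow_four _ (by fun_prop) ((2 * K * |t|) ^ 4) fun p ↦ ?_
  rw [abs_pow, ← mul_pow]
  gcongr
  exact abs_sub_rotation_le hg t p

lemma measurePreserving_rotation_stdGaussian (t : ℝ) :
    MeasurePreserving (ContinuousLinearMap.rotation t : E × E →L[ℝ] E × E)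
      ((stdGaussian E).prod (stdGaussian E)) ((stdGaussian E).prod (stdGaussian E)) :=
  ⟨by fun_prop, IsGaussian.map_rotation_eq_self (by simp) t⟩

/-- Splitting a quarter turn into `N` equal rotations bounds the fourth moment of the increment of
a Lipschitz function between two independent Gaussian vectors. -/
lemma integral_sub_pow_four_le_rotation {K : ℝ≥0} {g : E → ℝ} (hg : LipschitzWith K g) {N : ℕ}
    (hN : N ≠ 0) :
    ∫ p, (g p.1 - g p.2) ^ 4 ∂(stdGaussian E).prod (stdGaussian E) ≤
      ∫ p, (N * (g p.1 - g (ContinuousLinearMap.rotation (Real.pi / 2 / N) p).1)) ^ 4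
        ∂(stdGaussian E).prod (stdGaussian E) := by
  set δ : ℝ := Real.pi / 2 / N
  set D : E × E → ℝ := fun p ↦ g p.1 - g (ContinuousLinearMap.rotation δ p).1
  have hD : Integrable (fun p ↦ D p ^ 4) ((stdGaussian E).prod (stdGaussian E)) :=
    integrable_sub_rotation_pow_four hg δ
  have hrot (k : ℕ) : MeasurePreserving (ContinuousLinearMap.rotation (k * δ) : E × E →L[ℝ] E × E)
      ((stdGaussian E).prod (stdGaussian E)) ((stdGaussian E).prod (stdGaussian E)) :=
    measurePreserving_rotation_stdGaussian _
  have hDm : AEStronglyMeasurable (fun p ↦ D p ^ 4)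
    ((stdGaussian E).prod (stdGaussian E)) := hD.1
  have hDi (k : ℕ) : Integrable (fun p ↦ D (ContinuousLinearMap.rotation (k * δ) p) ^ 4)
      ((stdGaussian E).prod (stdGaussian E)) :=
    (hrot k).integrable_comp_of_integrable hD
  have hsum (p : E × E) : g p.1 - g p.2 =
      ∑ k ∈ Finset.range N, D (ContinuousLinearMap.rotation (k * δ) p) := by
    have h (k : ℕ) : D (ContinuousLinearMap.rotation (k * δ) p) =
        g (ContinuousLinearMap.rotation (k * δ) p).1 -
          g (ContinuousLinearMap.rotation ((k + 1 : ℕ) * δ) p).1 := by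
      simp only [D, rotation_add_apply]
      congr 5
      push_cast
      ring
    have hNδ : N * δ = Real.pi / 2 := by
      simp only [δ]
      field_simp
    rw [Finset.sum_congr rfl fun k _ ↦ h k,
      Finset.sum_range_sub' fun k : ℕ ↦ g (ContinuousLinearMap.rotation (k * δ) p).1, hNδ]
    simp [ContinuousLinearMap.rotation_apply]
  have hpt (p : E × E) : (g p.1 - g p.2) ^ 4 ≤
      N ^ 3 * ∑ k ∈ Finset.range N, D (ContinuousLinearMap.rotation (k * δ) p) ^ 4 := by
    have h := pow_sum_le_card_mul_sum_pow (s := Finset.range N)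
      (f := fun k : ℕ ↦ |D (ContinuousLinearMap.rotation (k * δ) p)|) (fun _ _ ↦ abs_nonneg _) 3
    simp only [Finset.card_range, Nat.reduceAdd, Even.pow_abs (show Even 4 by decide)] at h
    refine le_trans ?_ h
    rw [hsum, ← Even.pow_abs (show Even 4 by decide)]
    gcongr
    exact Finset.abs_sum_le_sum_abs _ _
  calc ∫ p, (g p.1 - g p.2) ^ 4 ∂(stdGaussian E).prod (stdGaussian E)
      ≤ ∫ p, N ^ 3 * ∑ k ∈ Finset.range N, D (ContinuousLinearMap.rotation (k * δ) p) ^ 4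
          ∂(stdGaussian E).prod (stdGaussian E) :=
        integral_mono_of_nonneg (.of_forall fun p ↦ by positivity)
          ((integrable_finsetSum _ fun k _ ↦ hDi k).const_mul _) (.of_forall hpt)
    _ = N ^ 3 * ∑ k ∈ Finset.range N, ∫ p, D p ^ 4 ∂(stdGaussian E).prod (stdGaussian E) := by
        rw [integral_const_mul, integral_finsetSum _ fun k _ ↦ hDi k]
        congr 2 with k
        conv_rhs => rw [← (hrot k).map_eq]
        rw [integral_map (hrot k).measurable.aemeasurable (by rwa [(hrot k).map_eq])]
    _ = ∫ p, (N * D p) ^ 4 ∂(stdGaussian E).prod (stdGaussian E) := by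
        simp_rw [mul_pow]
        rw [integral_const_mul]
        simp
        ring

lemma tendsto_mul_sub_rotation {F : Type*} [NormedAddCommGroup F] [NormedSpace ℝ F] {g : F → ℝ}
    {p : F × F} (hg : DifferentiableAt ℝ g p.1) :
    Tendsto (fun N : ℕ ↦ N * (g p.1 - g (ContinuousLinearMap.rotation (Real.pi / 2 / N) p).1))
      atTop (𝓝 (-(Real.pi / 2) * fderiv ℝ g p.1 p.2)) := by
  have hc : HasDerivAt (fun t : ℝ ↦ (ContinuousLinearMap.rotation t p).1) p.2 0 := by
    have h := ((Real.hasDerivAt_cos 0).smul_const p.1).add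
      ((Real.hasDerivAt_sin 0).smul_const p.2)
    simpa [ContinuousLinearMap.rotation_apply, Pi.add_def] using h
  have hc0 : (ContinuousLinearMap.rotation 0 p).1 = p.1 := by
    simp [ContinuousLinearMap.rotation_apply]
  have hgc : HasDerivAt (fun t : ℝ ↦ g (ContinuousLinearMap.rotation t p).1)
      (fderiv ℝ g p.1 p.2) 0 :=
    HasFDerivAt.comp_hasDerivAt (0 : ℝ) (f := fun t : ℝ ↦ (ContinuousLinearMap.rotation t p).1)
      (by rw [hc0]; exact hg.hasFDerivAt) hc
  have hδ : Tendsto (fun N : ℕ ↦ Real.pi / 2 / N) atTop (𝓝[≠] 0) := by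
    refine tendsto_nhdsWithin_iff.2 ⟨tendsto_const_div_atTop_nhds_zero_nat _, ?_⟩
    filter_upwards [eventually_ne_atTop 0] with N hN
    simp [Real.pi_ne_zero, hN]
  have h := ((hasDerivAt_iff_tendsto_slope_zero.1 hgc).comp hδ).const_mul (-(Real.pi / 2))
  refine h.congr' ?_
  filter_upwards [eventually_ne_atTop 0] with N hN
  have := Real.pi_ne_zero
  simp only [Function.comp_apply, zero_add, hc0, smul_eq_mul]
  field_simp
  ring

/-- **Maurey–Pisier**: the fourth moment of the increment of a Lipschitz function between two
independent Gaussian vectors is bounded independently of the dimension. -/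
lemma integral_sub_pow_four_stdGaussian_le {K : ℝ≥0} {g : E → ℝ} (hg : LipschitzWith K g) :
    ∫ p, (g p.1 - g p.2) ^ 4 ∂(stdGaussian E).prod (stdGaussian E) ≤
      (Real.pi / 2) ^ 4 * (∫ z, z ^ 4 ∂gaussianReal 0 1) * K ^ 4 := by
  have hgc := hg.continuous
  have hdiff : ∀ᵐ p ∂(stdGaussian E).prod (stdGaussian E), DifferentiableAt ℝ g p.1 :=
    Measure.quasiMeasurePreserving_fst.ae
      (stdGaussian_absolutelyContinuous.ae_le hg.ae_differentiableAt)
  have hnorm4 : Integrable (fun p : E × E ↦ ‖p‖ ^ 4) ((stdGaussian E).prod (stdGaussian E)) :=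
    integrable_of_abs_le_norm_pow_four _ (by fun_prop) 1 (by simp)
  have hlim : Tendsto (fun N : ℕ ↦
      ∫ p, (N * (g p.1 - g (ContinuousLinearMap.rotation (Real.pi / 2 / N) p).1)) ^ 4
        ∂(stdGaussian E).prod (stdGaussian E)) atTop
      (𝓝 (∫ p, (-(Real.pi / 2) * fderiv ℝ g p.1 p.2) ^ 4
        ∂(stdGaussian E).prod (stdGaussian E))) := by
    refine tendsto_integral_of_dominated_convergence (fun p ↦ (K * Real.pi) ^ 4 * ‖p‖ ^ 4)
      (fun N ↦ by fun_prop) (hnorm4.const_mul _) (fun N ↦ .of_forall fun p ↦ ?_) ?_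
    · rw [norm_pow, ← mul_pow]
      gcongr
      obtain rfl | hN := eq_or_ne N 0
      · simp
        positivity
      rw [norm_mul, Real.norm_natCast, Real.norm_eq_abs]
      calc N * |g p.1 - g (ContinuousLinearMap.rotation (Real.pi / 2 / N) p).1|
          ≤ N * (2 * K * |Real.pi / 2 / N| * ‖p‖) := by
            gcongr
            exact abs_sub_rotation_le hg _ p
        _ = K * Real.pi * ‖p‖ := by
            rw [abs_of_nonneg (by positivity)]
            field_simp
    · filter_upwards [hdiff] with p hp
      exact (tendsto_mul_sub_rotation hp).pow 4
  refine (ge_of_tendsto hlim ?_).trans ?_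
  · filter_upwards [eventually_ne_atTop 0] with N hN
    exact integral_sub_pow_four_le_rotation hg hN
  simp_rw [mul_pow]
  rw [integral_const_mul, neg_pow, Even.neg_one_pow (by decide), one_mul, mul_assoc]
  gcongr
  have hm : Measurable fun p : E × E ↦ fderiv ℝ g p.1 p.2 :=
    (isBoundedBilinearMap_apply (𝕜 := ℝ) (E := E) (F := ℝ)).continuous.measurable.comp
      (((measurable_fderiv ℝ g).comp measurable_fst).prodMk measurable_snd)
  have hi : Integrable (fun p : E × E ↦ fderiv ℝ g p.1 p.2 ^ 4)
      ((stdGaussian E).prod (stdGaussian E)) := by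
    refine integrable_of_abs_le_norm_pow_four _ (hm.pow_const 4).aestronglyMeasurable (K ^ 4)
      fun p ↦ ?_
    rw [abs_pow, ← mul_pow]
    gcongr
    calc |fderiv ℝ g p.1 p.2| ≤ ‖fderiv ℝ g p.1‖ * ‖p.2‖ := (fderiv ℝ g p.1).le_opNorm p.2
      _ ≤ K * ‖p‖ := by
        gcongr
        exacts [norm_fderiv_le_of_lipschitz ℝ hg, norm_snd_le p]
  rw [integral_prod _ hi]
  simp only [integral_strongDual_pow_four_stdGaussian]
  rw [mul_comm]
  have hK : 0 ≤ ∫ z, z ^ 4 ∂gaussianReal 0 1 := integral_nonneg fun z ↦ by positivity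
  calc ∫ x, ‖fderiv ℝ g x‖ ^ 4 * (∫ z, z ^ 4 ∂gaussianReal 0 1) ∂stdGaussian E
      ≤ ∫ _, K ^ 4 * (∫ z, z ^ 4 ∂gaussianReal 0 1) ∂stdGaussian E := by
        refine integral_mono_of_nonneg (.of_forall fun x ↦ by positivity) (integrable_const _)
          (.of_forall fun x ↦ ?_)
        dsimp only
        gcongr
        exact norm_fderiv_le_of_lipschitz ℝ hg
    _ = K ^ 4 * ∫ z, z ^ 4 ∂gaussianReal 0 1 := by simp

lemma integral_pow_four_stdGaussian_le {K : ℝ≥0} {g : E → ℝ} (hg : LipschitzWith K g)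
    (hg0 : g 0 = 0) (hmean : ∫ x, g x ∂stdGaussian E = 0) :
    ∫ x, g x ^ 4 ∂stdGaussian E ≤
      (Real.pi / 2) ^ 4 * (∫ z, z ^ 4 ∂gaussianReal 0 1) * K ^ 4 := by
  have hgc := hg.continuous
  have hb (x : E) : |g x| ≤ K * ‖x‖ := by
    simpa [Real.dist_eq, hg0] using hg.dist_le_mul x 0
  have h4 : Integrable (fun x ↦ g x ^ 4) (stdGaussian E) := by
    refine integrable_of_abs_le_norm_pow_four _ (by fun_prop) (K ^ 4) fun x ↦ ?_
    rw [abs_pow, ← mul_pow]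
    gcongr
    exact hb x
  have h4' : Integrable (fun p : E × E ↦ g p.1 ^ 4) ((stdGaussian E).prod (stdGaussian E)) :=
    h4.comp_fst _
  have hcross : Integrable (fun p : E × E ↦ g p.1 ^ 3 * g p.2)
      ((stdGaussian E).prod (stdGaussian E)) := by
    refine integrable_of_abs_le_norm_pow_four _ (by fun_prop) (K ^ 4) fun p ↦ ?_
    calc |g p.1 ^ 3 * g p.2| = |g p.1| ^ 3 * |g p.2| := by rw [abs_mul, abs_pow]
      _ ≤ (K * ‖p‖) ^ 3 * (K * ‖p‖) := by
        gcongr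
        · exact (hb _).trans (by gcongr; exact norm_fst_le p)
        · exact (hb _).trans (by gcongr; exact norm_snd_le p)
      _ = K ^ 4 * ‖p‖ ^ 4 := by ring
  have hsub : Integrable (fun p : E × E ↦ (g p.1 - g p.2) ^ 4)
      ((stdGaussian E).prod (stdGaussian E)) := by
    refine integrable_of_abs_le_norm_pow_four _ (by fun_prop) ((2 * K) ^ 4) fun p ↦ ?_
    rw [abs_pow, ← mul_pow]
    gcongr
    calc |g p.1 - g p.2| ≤ |g p.1| + |g p.2| := abs_sub _ _
      _ ≤ K * ‖p‖ + K * ‖p‖ := add_le_add ((hb _).trans (by gcongr; exact norm_fst_le p))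
        ((hb _).trans (by gcongr; exact norm_snd_le p))
      _ = 2 * K * ‖p‖ := by ring
  refine le_trans ?_ (integral_sub_pow_four_stdGaussian_le hg)
  calc ∫ x, g x ^ 4 ∂stdGaussian E
      = ∫ p, (g p.1 ^ 4 - 4 * (g p.1 ^ 3 * g p.2)) ∂(stdGaussian E).prod (stdGaussian E) := by
        rw [integral_sub h4' (hcross.const_mul 4), integral_const_mul,
          integral_prod_mul (fun x ↦ g x ^ 3) g, hmean,
          integral_fun_fst fun x ↦ g x ^ 4]
        simp
    _ ≤ _ := by
        refine integral_mono (h4'.sub (hcross.const_mul 4)) hsub fun p ↦ ?_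
        dsimp only
        nlinarith [mul_nonneg (sq_nonneg (g p.2))
          (add_nonneg (sq_nonneg (g p.2 - 2 * g p.1)) (sq_nonneg (g p.1)))]

end Gaussian

section RadialExtension

variable {E : Type*} [NormedAddCommGroup E] [NormedSpace ℝ E]

lemma norm_inv_norm_smul_le_one (x : E) : ‖‖x‖⁻¹ • x‖ ≤ 1 := by
  rw [norm_smul, norm_inv, norm_norm]
  exact inv_mul_le_one

lemma norm_smul_inv_norm_smul_self (x : E) : ‖x‖ • ‖x‖⁻¹ • x = x := by
  obtain rfl | hx := eq_or_ne x 0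
  · simp
  · rw [smul_inv_smul₀ (norm_ne_zero_iff.2 hx)]

/-- The positively homogeneous extension of a Lipschitz function on the unit sphere is
Lipschitz. -/
lemma lipschitzWith_norm_mul_direction {K M : ℝ≥0} {ψ : E → ℝ} (hψ : LipschitzWith K ψ)
    (hM : ∀ x, ‖x‖ ≤ 1 → |ψ x| ≤ M) :
    LipschitzWith (M + 2 * K) fun x ↦ ‖x‖ * ψ (‖x‖⁻¹ • x) := by
  refine LipschitzWith.of_dist_le_mul fun x y ↦ ?_
  rw [Real.dist_eq, dist_eq_norm]
  have hxy : |‖x‖ - ‖y‖| ≤ ‖x - y‖ := abs_norm_sub_norm_le x y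
  have hdir : ‖y‖ * ‖‖x‖⁻¹ • x - ‖y‖⁻¹ • y‖ ≤ 2 * ‖x - y‖ := by
    have heq : ‖y‖ • (‖x‖⁻¹ • x - ‖y‖⁻¹ • y) =
        (x - y) - (‖x‖ - ‖y‖) • (‖x‖⁻¹ • x) := by
      rw [smul_sub, sub_smul, norm_smul_inv_norm_smul_self, norm_smul_inv_norm_smul_self]
      abel
    calc ‖y‖ * ‖‖x‖⁻¹ • x - ‖y‖⁻¹ • y‖ = ‖(x - y) - (‖x‖ - ‖y‖) • (‖x‖⁻¹ • x)‖ := by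
          rw [← heq, norm_smul, norm_norm]
      _ ≤ ‖x - y‖ + |‖x‖ - ‖y‖| * ‖‖x‖⁻¹ • x‖ := by
          refine (norm_sub_le _ _).trans_eq ?_
          rw [norm_smul (‖x‖ - ‖y‖), Real.norm_eq_abs]
      _ ≤ ‖x - y‖ + ‖x - y‖ * 1 := by
          gcongr
          exact norm_inv_norm_smul_le_one x
      _ = 2 * ‖x - y‖ := by ring
  have hψxy : |ψ (‖x‖⁻¹ • x) - ψ (‖y‖⁻¹ • y)| ≤ K * ‖‖x‖⁻¹ • x - ‖y‖⁻¹ • y‖ := by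
    simpa [Real.dist_eq, dist_eq_norm] using hψ.dist_le_mul (‖x‖⁻¹ • x) (‖y‖⁻¹ • y)
  calc |‖x‖ * ψ (‖x‖⁻¹ • x) - ‖y‖ * ψ (‖y‖⁻¹ • y)|
      = |(‖x‖ - ‖y‖) * ψ (‖x‖⁻¹ • x) + ‖y‖ * (ψ (‖x‖⁻¹ • x) - ψ (‖y‖⁻¹ • y))| := by
        congr 1
        ring
    _ ≤ |‖x‖ - ‖y‖| * |ψ (‖x‖⁻¹ • x)| + ‖y‖ * |ψ (‖x‖⁻¹ • x) - ψ (‖y‖⁻¹ • y)| := by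
        refine (abs_add_le _ _).trans_eq ?_
        rw [abs_mul, abs_mul, abs_norm]
    _ ≤ ‖x - y‖ * M + ‖y‖ * (K * ‖‖x‖⁻¹ • x - ‖y‖⁻¹ • y‖) := by
        gcongr
        exact hM _ (norm_inv_norm_smul_le_one x)
    _ = ‖x - y‖ * M + K * (‖y‖ * ‖‖x‖⁻¹ • x - ‖y‖⁻¹ • y‖) := by ring
    _ ≤ ‖x - y‖ * M + K * (2 * ‖x - y‖) := by gcongr
    _ = (M + 2 * K : ℝ≥0) * ‖x - y‖ := by
        push_cast
        ring

end RadialExtension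

lemma ae_norm_le_one_sphereUniform (d : ℕ) : ∀ᵐ u ∂sphereUniform d, ‖u‖ ≤ 1 := by
  have hm : Measurable fun v : EuclideanSpace ℝ (Fin d) ↦ ‖v‖⁻¹ • v := by fun_prop
  rw [sphereUniform, ae_map_iff hm.aemeasurable (measurableSet_le (by fun_prop) (by fun_prop))]
  exact .of_forall norm_inv_norm_smul_le_one

lemma abs_sub_integral_sphereUniform_le {d : ℕ} {K : ℝ≥0} {h : EuclideanSpace ℝ (Fin d) → ℝ}
    (hh : LipschitzWith K h) {x : EuclideanSpace ℝ (Fin d)} (hx : ‖x‖ ≤ 1) :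
    |h x - ∫ u, h u ∂sphereUniform d| ≤ 2 * K := by
  have hb : ∀ᵐ u ∂sphereUniform d, ‖h u - h x‖ ≤ 2 * K := by
    filter_upwards [ae_norm_le_one_sphereUniform d] with u hu
    calc ‖h u - h x‖ ≤ K * ‖u - x‖ := by
          simpa [Real.dist_eq, dist_eq_norm] using hh.dist_le_mul u x
      _ ≤ K * (1 + 1) := by
          gcongr
          exact (norm_sub_le _ _).trans (add_le_add hu hx)
      _ = 2 * K := by ring
  have hc := hh.continuous
  have hi : Integrable (fun u ↦ h u - h x) (sphereUniform d) :=
    .of_bound (by fun_prop) _ hb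
  have hi' : Integrable h (sphereUniform d) := by
    exact (hi.add (integrable_const (h x))).congr (.of_forall fun u ↦ by simp)
  have h1 := norm_integral_le_of_norm_le_const hb
  rw [integral_sub hi' (integrable_const _)] at h1
  rw [abs_sub_comm]
  simpa using h1

lemma integral_sub_mean_pow_four_sphereUniform_le {d : ℕ} (hd : d ≠ 0) {K : ℝ≥0}
    {h : EuclideanSpace ℝ (Fin d) → ℝ} (hh : LipschitzWith K h) :
    d ^ 2 * ∫ u, (h u - ∫ u', h u' ∂sphereUniform d) ^ 4 ∂sphereUniform d ≤
      (Real.pi / 2) ^ 4 * (∫ z, z ^ 4 ∂gaussianReal 0 1) * (4 * K) ^ 4 := by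
  have hc := hh.continuous
  set m := ∫ u, h u ∂sphereUniform d
  have hψ : LipschitzWith K fun x ↦ h x - m := by
    simpa using hh.sub (LipschitzWith.const m)
  have hi : Integrable h (sphereUniform d) := by
    refine .of_bound (by fun_prop) (2 * K + |m|) ?_
    filter_upwards [ae_norm_le_one_sphereUniform d] with u hu
    have := abs_sub_integral_sphereUniform_le hh hu
    calc ‖h u‖ = |(h u - m) + m| := by simp
      _ ≤ |h u - m| + |m| := abs_add_le _ _
      _ ≤ _ := by gcongr
  have hmean : ∫ u, (h u - m) ∂sphereUniform d = 0 := by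
    rw [integral_sub hi (integrable_const _)]
    simp [m]
  have hlip := lipschitzWith_norm_mul_direction (M := 2 * K) hψ fun x hx ↦ by
    simpa using abs_sub_integral_sphereUniform_le hh hx
  have hg := integral_pow_four_stdGaussian_le hlip (by simp) (by
    rw [integral_stdGaussian_norm_mul_direction hd (φ := fun x ↦ h x - m) (by fun_prop) fun r ↦ r,
      hmean, zero_mul])
  simp_rw [mul_pow] at hg
  rw [integral_stdGaussian_norm_mul_direction hd (φ := fun x ↦ (h x - m) ^ 4) (by fun_prop)
    fun r ↦ r ^ 4] at hg
  calc d ^ 2 * ∫ u, (h u - m) ^ 4 ∂sphereUniform d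
      ≤ (∫ x, ‖x‖ ^ 4 ∂stdGaussian (EuclideanSpace ℝ (Fin d))) *
          ∫ u, (h u - m) ^ 4 ∂sphereUniform d := by
        gcongr
        exact sq_le_integral_norm_pow_four_stdGaussian d
    _ ≤ _ := by
        rw [mul_comm]
        refine hg.trans_eq ?_
        push_cast
        ring

/-- Lemma 6 ([Shamir 2017, Lemma 9]): there is a universal constant `c > 0` such that for
every `L`-Lipschitz `h : ℝ^d → ℝ`, `√(E[(h(u) − E[h(u)])⁴]) ≤ c L²/d` for `u` uniform on
the unit sphere. -/
theorem stmt5 :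
    ∃ c : ℝ, 0 < c ∧
      ∀ (d : ℕ), 1 ≤ d → ∀ L : ℝ, 0 ≤ L →
        ∀ h : EuclideanSpace ℝ (Fin d) → ℝ,
          (∀ x y, |h x - h y| ≤ L * ‖x - y‖) →
          Real.sqrt (∫ u, (h u - ∫ u', h u' ∂(sphereUniform d)) ^ 4 ∂(sphereUniform d)) ≤
            c * L ^ 2 / d := by
  set κ : ℝ := (Real.pi / 2) ^ 4 * (∫ z, z ^ 4 ∂gaussianReal 0 1) * 4 ^ 4
  have hκ : 0 ≤ κ := by
    have : 0 ≤ ∫ z, z ^ 4 ∂gaussianReal 0 1 := integral_nonneg fun z ↦ by positivity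
    positivity
  refine ⟨√κ + 1, by positivity, fun d hd L hL h hh ↦ ?_⟩
  lift L to ℝ≥0 using hL
  have hlip : LipschitzWith L h := LipschitzWith.of_dist_le_mul fun x y ↦ by
    simpa [Real.dist_eq, dist_eq_norm] using hh x y
  have hd' : (0 : ℝ) < d := by exact_mod_cast hd
  have key := integral_sub_mean_pow_four_sphereUniform_le (by omega) hlip
  refine Real.sqrt_le_iff.2 ⟨by positivity, ?_⟩
  have hle : κ ≤ (√κ + 1) ^ 2 := by
    nlinarith [Real.sq_sqrt hκ, Real.sqrt_nonneg κ]
  rw [div_pow, le_div_iff₀ (by positivity), mul_comm]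
  calc _ ≤ κ * L ^ 4 := key.trans_eq (by simp only [κ]; ring)
    _ ≤ (√κ + 1) ^ 2 * L ^ 4 := by gcongr
    _ = ((√κ + 1) * L ^ 2) ^ 2 := by ring
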